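/- Let G = ([n], E) be a natural unit interval graph and let σ and τ be permutations of [n] that are G-equivalent, meaning that for every edge {a,b} ∈ E, a precedes b in the one-line notation of σ if and only if a precedes b in the one-line notation of τ. If every descent of σ is a G-descent and every descent of τ is a G-descent, then σ = τ. Moreover, the unique such permutation in each G-equivalence class is the lexicographically smallest element of that class (comparing one-line notations (σ_1, …, σ_n) lexicographically). -/

import Mathlib

open Classical

/-- `G` is a natural unit interval graph: for every edge `{i,j}` with `i < j` and every
`i < k < j`, both `{i,k}` and `{k,j}` are edges. -/
def IsNaturalUnitIntervalGraph {n : ℕ} (G : SimpleGraph (Fin n)) : Prop :=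
  ∀ i j k : Fin n, G.Adj i j → i < k → k < j → G.Adj i k ∧ G.Adj k j

/-- Every descent of `σ` is a `G`-descent: whenever `σ_t > σ_{t+1}`,
`{σ_t, σ_{t+1}}` is an edge of `G`. -/
def AllDescentsGDescents {n : ℕ} (G : SimpleGraph (Fin n)) (σ : Equiv.Perm (Fin n)) : Prop :=
  ∀ (t : ℕ) (h : t + 1 < n), σ ⟨t + 1, h⟩ < σ ⟨t, Nat.lt_of_succ_lt h⟩ →
    G.Adj (σ ⟨t, Nat.lt_of_succ_lt h⟩) (σ ⟨t + 1, h⟩)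

/-- Permutations `σ` and `τ` of `[n]` are `G`-equivalent: for every edge `{a,b}` of `G`,
`a` precedes `b` in the one-line notation of `σ` iff it does so in `τ`. -/
def GEquiv {n : ℕ} (G : SimpleGraph (Fin n)) (σ τ : Equiv.Perm (Fin n)) : Prop :=
  ∀ a b : Fin n, G.Adj a b → (σ.symm a < σ.symm b ↔ τ.symm a < τ.symm b)

theorem GEquiv.symm {n : ℕ} {G : SimpleGraph (Fin n)} {σ τ : Equiv.Perm (Fin n)}
    (h : GEquiv G σ τ) : GEquiv G τ σ :=
  fun a b hab => (h a b hab).symm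

/-- If `b < σ t` is not adjacent to any of the values of `σ` at positions from `t` up to that of
`b`, then those values all stay above `b`. -/
theorem AllDescentsGDescents.lt_apply {n : ℕ} {G : SimpleGraph (Fin n)}
    (hG : IsNaturalUnitIntervalGraph G) {σ : Equiv.Perm (Fin n)} (hσ : AllDescentsGDescents G σ)
    {t b : Fin n} (hb : b < σ t) (hadj : ∀ s, t ≤ s → s < σ.symm b → ¬ G.Adj (σ s) b)
    (s : ℕ) (hts : t.val ≤ s) (hsq : s ≤ (σ.symm b).val) :
    b < σ ⟨s, hsq.trans_lt (σ.symm b).isLt⟩ := by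
  induction s, hts using Nat.le_induction with
  | base => exact hb
  | succ s hts ih =>
    have hs := ih (by omega)
    have hna := hadj ⟨s, by omega⟩ hts (Fin.lt_def.2 (by simpa using hsq))
    by_contra! hle
    have hedge := hσ s (by omega) (hle.trans_lt hs)
    rcases hle.eq_or_lt with heq | hlt
    · rw [heq] at hedge
      exact hna hedge
    · exact hna (hG _ _ _ hedge.symm hlt hs).2.symm

theorem AllDescentsGDescents.apply_le_of_eq_before {n : ℕ} {G : SimpleGraph (Fin n)}
    (hG : IsNaturalUnitIntervalGraph G) {σ τ : Equiv.Perm (Fin n)}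
    (hσ : AllDescentsGDescents G σ) (hequiv : GEquiv G σ τ) {t : Fin n}
    (ht : ∀ s < t, σ s = τ s) : σ t ≤ τ t := by
  by_contra! hlt
  have htq : t ≤ σ.symm (τ t) := by
    by_contra! h
    have h' := ht _ h
    rw [Equiv.apply_symm_apply] at h'
    exact h.ne (τ.injective h').symm
  have key := hσ.lt_apply hG hlt (fun s hts hsq hadj => ?_) (σ.symm (τ t)) htq le_rfl
  · simp at key
  · have hs := (hequiv _ _ hadj).1 (by simpa using hsq)
    rw [Equiv.symm_apply_apply] at hs
    have h' := ht _ hs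
    rw [Equiv.apply_symm_apply] at h'
    exact (hts.trans_lt (σ.injective h' ▸ hs)).false

theorem AllDescentsGDescents.exists_lex_lt {n : ℕ} {G : SimpleGraph (Fin n)}
    (hG : IsNaturalUnitIntervalGraph G) {σ τ : Equiv.Perm (Fin n)}
    (hσ : AllDescentsGDescents G σ) (hequiv : GEquiv G σ τ) (hne : σ ≠ τ) :
    ∃ t : Fin n, (∀ s : Fin n, s < t → σ s = τ s) ∧ σ t < τ t := by
  have hdiff : {t | σ t ≠ τ t}.Nonempty := by
    by_contra! h
    exact hne (Equiv.ext fun t => by simpa using Set.eq_empty_iff_forall_notMem.1 h t)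
  obtain ⟨t, ht, hmin⟩ := wellFounded_lt.has_min _ hdiff
  have heq : ∀ s < t, σ s = τ s := fun s hs => by
    by_contra h
    exact hmin s h hs
  exact ⟨t, heq, (hσ.apply_le_of_eq_before hG hequiv heq).lt_of_ne ht⟩

/-- in each `G`-equivalence class of permutations there is a unique
permutation all of whose descents are `G`-descents, and it is the lexicographically
smallest element of the class. -/
theorem G_local_min_unique_and_lex_min {n : ℕ} (G : SimpleGraph (Fin n))
    (hG : IsNaturalUnitIntervalGraph G)
    (σ τ : Equiv.Perm (Fin n)) (hequiv : GEquiv G σ τ)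
    (hσ : AllDescentsGDescents G σ) (hτ : AllDescentsGDescents G τ) :
    σ = τ ∧
      ∀ τ' : Equiv.Perm (Fin n), GEquiv G σ τ' → σ ≠ τ' →
        ∃ t : Fin n, (∀ s : Fin n, s < t → σ s = τ' s) ∧ σ t < τ' t := by
  refine ⟨?_, fun τ' h hne => hσ.exists_lex_lt hG h hne⟩
  by_contra hne
  obtain ⟨t, ht, hlt⟩ := hσ.exists_lex_lt hG hequiv hne
  obtain ⟨u, hu, hult⟩ := hτ.exists_lex_lt hG hequiv.symm (Ne.symm hne)
  rcases lt_trichotomy t u with h | rfl | h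
  · exact hlt.ne (hu t h).symm
  · exact hlt.asymm hult
  · exact hult.ne (ht u h).symm
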